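/- (Lemma 1(i)) Let f be a feasible flow in a rooted tree instance I(e) with e=(u,v), let t ∈ T_e, and let X_t be a t-set with f(X_t) = f(e_t). Then every positive-path P_{s,s'} of f with s,s' ∈ T_e ∪ {u} contains exactly one edge of E(X_t) if t ∈ {s,s'}, and is vertex-disjoint from X_t otherwise. -/

import Mathlib

open Classical

/-- `⟨a,b⟩`: the set `{a, a+2, …, b}` of consecutive odd or even integers. -/
def Iv (a b : ℕ) : Set ℕ := {x | a ≤ x ∧ x ≤ b ∧ x % 2 = a % 2}

/-- `A ⊗ B = {a + b − 2i : a ∈ A, b ∈ B, 0 ≤ i ≤ min(a,b)}`. -/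
def otimes (A B : Set ℕ) : Set ℕ :=
  {x | ∃ a ∈ A, ∃ b ∈ B, ∃ i, i ≤ min a b ∧ x = a + b - 2 * i}

/-- A tree instance `(G,T,c)` rooted at a terminal `r`: a tree on vertex set `V`,
encoded by the parent function `par` (with `par root = root`) together with a depth
function certifying acyclicity.  Each non-root vertex `v` is identified with the edge
`(par v, v)`; `c v` is the (positive integer) capacity of that edge.  The terminals are
the leaves; the root has exactly one child and every internal vertex has exactly
two children (total degree 3). -/
structure RTI (V : Type*) where
  root : V
  par : V → V
  dep : V → ℕ
  c : V → ℕ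
  par_root : par root = root
  dep_root : dep root = 0
  dep_par : ∀ v, v ≠ root → dep v = dep (par v) + 1
  cap_pos : ∀ v, v ≠ root → 1 ≤ c v
  root_degree : {w : V | par w = root ∧ w ≠ root}.ncard = 1
  internal_degree : ∀ v, v ≠ root → {w : V | par w = v ∧ w ≠ root}.Nonempty →
    {w : V | par w = v ∧ w ≠ root}.ncard = 2

namespace RTI

variable {V : Type*} (R : RTI V)

/-- `R.below u v`: `v` lies in the subtree rooted at `u` (i.e. `u` is an ancestor of
`v`, allowing `u = v`). -/
def below (u v : V) : Prop :=
  Relation.ReflTransGen (fun a b => R.par b = a ∧ b ≠ R.root) u v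

/-- `v` is a leaf of the tree other than the root. -/
def leaf (v : V) : Prop := v ≠ R.root ∧ ∀ w, w ≠ R.root → R.par w ≠ v

/-- The children of `v` (as lower endpoints of child-edges). -/
def children (v : V) : Set V := {w | R.par w = v ∧ w ≠ R.root}

/-- For an edge `e = (par v, v)`, the vertex set `V_e` of the instance `I(e)`. -/
def Ve (v : V) : Set V := insert (R.par v) {w | R.below v w}

/-- `T_e`: the terminals of `I(e)` other than `u = par v`. -/
def Te (v : V) : Set V := {w | R.below v w ∧ R.leaf w}

/-- The full terminal set `T_e ∪ {u}` of the instance `I(e)`. -/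
def S (v : V) : Set V := insert (R.par v) (R.Te v)

/-- The edge `(par x, x)` lies on the tree path between `t` and `t'`
(exactly one of `t, t'` is in the subtree below `x`). -/
def onPath (x t t' : V) : Prop :=
  (R.below x t ∧ ¬ R.below x t') ∨ (¬ R.below x t ∧ R.below x t')

/-- The vertex `x` lies on the tree path between `t` and `t'`. -/
def onPathV (x t t' : V) : Prop :=
  (R.below x t ∨ R.below x t') ∧ ∀ z, R.below z t → R.below z t' → R.below z x

/-- Unordered pairs of distinct terminals of the instance `I(e)` for `e = (par v, v)`. -/
def PathPairs (v : V) : Set (Sym2 V) :=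
  {p | ∃ t t', t ∈ R.S v ∧ t' ∈ R.S v ∧ t ≠ t' ∧ p = s(t, t')}

/-- `g` is a decomposition of `f` in the instance `I(e)`, `e = (par v, v)`:
`g` is supported on pairs of distinct terminals and, on every edge of `I(e)`,
`f` is the sum of `g` over the (unique) terminal-pair paths through that edge. -/
def IsDecomp (v : V) (f : V → ℕ) (g : Sym2 V → ℕ) : Prop :=
  (∀ p, g p ≠ 0 → p ∈ R.PathPairs v) ∧
  ∀ w, R.below v w →
    f w = ∑ᶠ p ∈ {p : Sym2 V | ∃ t t', p = s(t, t') ∧ R.onPath w t t'}, g p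

/-- `f` is an (integral) flow in the instance `I(e)`, `e = (par v, v)`. -/
def IsFlow (v : V) (f : V → ℕ) : Prop := ∃ g, R.IsDecomp v f g

/-- `f` is feasible in `I(e)`. -/
def Feasible (v : V) (f : V → ℕ) : Prop := ∀ w, R.below v w → f w ≤ R.c w

/-- `V_f(s)`: the set of vertices `w` of `I(e)` reachable from `s` by travelling
upward along edges with `c − f ≥ 1` to a common ancestor and then downward along
edges with `c − f ≥ 2`. -/
def Vf (v : V) (f : V → ℕ) (s : V) : Set V :=
  {w | w ∈ R.Ve v ∧ ∃ z ∈ R.Ve v, R.below z s ∧ R.below z w ∧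
    (∀ x, R.below z x → R.below x s → x ≠ z → f x + 1 ≤ R.c x) ∧
    (∀ x, R.below z x → R.below x w → x ≠ z → f x + 2 ≤ R.c x)}

/-- `W` induces a connected subgraph of the tree (it is closed under tree paths). -/
def ConnSet (W : Set V) : Prop :=
  ∀ w₁ ∈ W, ∀ w₂ ∈ W, ∀ x, R.onPathV x w₁ w₂ → x ∈ W

/-- `E(X)` inside the instance `I(e)`, `e = (par v, v)`: the edges `(par x, x)` of
`I(e)` with exactly one endpoint in `X`. -/
def cutE (v : V) (X : Set V) : Set V :=
  {x | R.below v x ∧ ¬ (x ∈ X ↔ R.par x ∈ X)}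

/-- `h(X) = Σ_{e' ∈ E(X)} h(e')` inside the instance `I(e)`, `e = (par v, v)`. -/
noncomputable def hval (v : V) (X : Set V) (h : V → ℕ) : ℕ := ∑ᶠ x ∈ R.cutE v X, h x

/-- `W` is a connected component of the subgraph of `I(e)` induced by `A`. -/
def IsComp (v : V) (A W : Set V) : Prop :=
  W.Nonempty ∧ W ⊆ A ∧ R.ConnSet W ∧
  (∀ x, R.below v x → x ∈ W → R.par x ∈ A → R.par x ∈ W) ∧
  (∀ x, R.below v x → R.par x ∈ W → x ∈ A → x ∈ W)

/-- `odd(X)` (relative to the union `U` of the removed terminal sets): the components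
`W` of `G_e − U` with `c(W)` odd whose parent-edge is a child-edge of `X`. -/
def oddOf (v : V) (U X : Set V) : Set (Set V) :=
  {W | R.IsComp v (R.Ve v \ U) W ∧ Odd (R.hval v W R.c) ∧
    ∃ y ∈ W, R.par y ∉ W ∧ R.par y ∈ X}

/-- The union of the sets `V_f(t)`, `t ∈ T_e`. -/
def UT (v : V) (f : V → ℕ) : Set V := ⋃ t ∈ R.Te v, R.Vf v f t

/-- The union of the sets `V_f(t)`, `t ∈ T_e ∪ {u}`. -/
def USall (v : V) (f : V → ℕ) : Set V := ⋃ t ∈ R.S v, R.Vf v f t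

/-- `f` is a blocking flow in `I(e)`, `e = (par v, v)`: a feasible flow such that
`{V_f(t) : t ∈ T_e}` is a cut-system of `T_e` (pairwise disjoint `t`-sets avoiding the
terminal `u = par v`) each member of which is blocked by `f`, i.e.
`f(e_t) = f(V_f(t)) = c(V_f(t)) − |odd(V_f(t))|`. -/
def IsBlocking (v : V) (f : V → ℕ) : Prop :=
  R.IsFlow v f ∧ R.Feasible v f ∧
  (∀ t ∈ R.Te v, R.par v ∉ R.Vf v f t) ∧
  (∀ t ∈ R.Te v, ∀ t' ∈ R.Te v, t ≠ t' → R.Vf v f t ∩ R.Vf v f t' = ∅) ∧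
  (∀ t ∈ R.Te v, f t = R.hval v (R.Vf v f t) f ∧
    R.hval v (R.Vf v f t) f + (R.oddOf v (R.UT v f) (R.Vf v f t)).ncard
      = R.hval v (R.Vf v f t) R.c)

/-- `Ψ(e)`: the set of values `f(e)` of blocking flows `f` of `I(e)`, `e = (par v, v)`. -/
def Psi (v : V) : Set ℕ := {x | ∃ f, R.IsBlocking v f ∧ f v = x}

/-- `a(e)`: the least element of `Ψ(e)`. -/
noncomputable def aE (v : V) : ℕ := sInf (R.Psi v)

/-- `b(e)`: the greatest element of `Ψ(e)`. -/
noncomputable def bE (v : V) : ℕ := sSup (R.Psi v)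

/-- The edge `(par x, x)` is dominating: `b(e') + 2 ≤ a(e)` for its sibling edge `e'`. -/
def Dominating (x : V) : Prop :=
  x ≠ R.root ∧ ∃ y, y ≠ R.root ∧ y ≠ x ∧ R.par y = R.par x ∧ R.bE y + 2 ≤ R.aE x

/-- The path from `v` down to `t` consists of dominating edges. -/
def DomPath (v t : V) : Prop :=
  R.below v t ∧ ∀ x, R.below v x → R.below x t → x ≠ v → R.Dominating x

/-- Condition (a) for the edge `e = (par v, v)`. -/
def CondA (v : V) : Prop :=
  (∃ a b, R.Psi v = Iv a b) ∧
  (R.leaf v → R.Psi v = {R.c v}) ∧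
  (∀ w₁ w₂, w₁ ≠ w₂ → R.children v = {w₁, w₂} →
    R.Psi v = (otimes (R.Psi w₁) (R.Psi w₂) ∩ Set.Iic (R.c v)) ∪ {R.c v})

/-- Condition (b) for the edge `e = (u,v)`: if `e` has a dominating child-edge
`e' = (v,w)`, then there is a terminal `t ∈ T_{e'}` with `g(u,t) ≥ a(e)` for every
decomposition `g` of every blocking flow of `I(e)`, and `P_{v,t}` a dominating path. -/
def CondB (v : V) : Prop :=
  ∀ w ∈ R.children v, R.Dominating w →
    ∃ t ∈ R.Te w, R.DomPath v t ∧
      ∀ f g, R.IsBlocking v f → R.IsDecomp v f g → R.aE v ≤ g s(R.par v, t)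

/-- `γ(𝒳)` for the cut-system `𝒳 = {V_f(t) : t ∈ T_e ∪ {u}}`. -/
noncomputable def gammaX (v : V) (f : V → ℕ) : ℕ :=
  ∑ᶠ t ∈ R.S v, R.hval v (R.Vf v f t) R.c

/-- `κ(𝒳)` for the cut-system `𝒳 = {V_f(t) : t ∈ T_e ∪ {u}}`: the number of
components of `G_e − ∪𝒳` of odd capacity. -/
noncomputable def kappaX (v : V) (f : V → ℕ) : ℕ :=
  {W : Set V | R.IsComp v (R.Ve v \ R.USall v f) W ∧ Odd (R.hval v W R.c)}.ncard

end RTI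

namespace RTI

variable {V : Type*} {R : RTI V}

/-- A vertex below `a` is `a` itself, or its parent is below `a`. -/
theorem below.eq_or_par {a b : V} (h : R.below a b) :
    b = a ∨ (b ≠ R.root ∧ R.below a (R.par b)) := by
  rcases Relation.ReflTransGen.cases_tail h with h | ⟨c, hc, rfl, hb⟩
  · exact Or.inl h
  · exact Or.inr ⟨hb, hc⟩

theorem below_par {a : V} (h : a ≠ R.root) : R.below (R.par a) a :=
  Relation.ReflTransGen.single ⟨rfl, h⟩

theorem below.dep_le {a b : V} (h : R.below a b) : R.dep a ≤ R.dep b := by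
  induction h with
  | refl => exact le_rfl
  | tail _ h ih =>
    obtain ⟨rfl, hb⟩ := h
    have := R.dep_par _ hb
    omega

theorem below.antisymm {a b : V} (h : R.below a b) (h' : R.below b a) : a = b := by
  rcases h.eq_or_par with h | ⟨hb, h⟩
  · exact h.symm
  · have := h.dep_le
    have := h'.dep_le
    have := R.dep_par _ hb
    omega

/-- The ancestors of a vertex form a chain. -/
theorem below.total {a b s : V} (ha : R.below a s) (hb : R.below b s) :
    R.below a b ∨ R.below b a := by
  induction ha with
  | refl => exact Or.inr hb
  | tail h h' ih =>
    rcases hb.eq_or_par with rfl | ⟨_, hb⟩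
    · exact Or.inl (h.tail h')
    · exact ih (h'.1 ▸ hb)

theorem onPath.symm {x t t' : V} (h : R.onPath x t t') : R.onPath x t' t := by
  unfold onPath at *
  tauto

theorem below_root (v : V) : R.below R.root v := by
  induction hn : R.dep v generalizing v with
  | zero =>
    by_cases hv : v = R.root
    · exact hv ▸ Relation.ReflTransGen.refl
    · have := R.dep_par v hv
      omega
  | succ n ih =>
    by_cases hv : v = R.root
    · exact hv ▸ Relation.ReflTransGen.refl
    · have := R.dep_par v hv
      exact (ih (R.par v) (by omega)).trans (below_par hv)

/-- Any two vertices have a lowest common ancestor. -/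
theorem exists_lca [Finite V] (R : RTI V) (s s' : V) :
    ∃ z, R.below z s ∧ R.below z s' ∧ ∀ y, R.below y s → R.below y s' → R.below y z := by
  obtain ⟨z, ⟨hz, hz'⟩, hmax⟩ := Set.exists_max_image {z | R.below z s ∧ R.below z s'} R.dep
    (Set.toFinite _) ⟨R.root, below_root s, below_root s'⟩
  refine ⟨z, hz, hz', fun y hy hy' => ?_⟩
  rcases hz.total hy with h | h
  · rcases h.eq_or_par with rfl | ⟨hb, h⟩
    · exact Relation.ReflTransGen.refl
    · have := hmax y ⟨hy, hy'⟩
      have := h.dep_le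
      have := R.dep_par _ hb
      omega
  · exact h

theorem par_not_below {v : V} (hv : v ≠ R.root) : ¬ R.below v (R.par v) := fun h => by
  have := h.dep_le
  have := R.dep_par v hv
  omega

theorem below_par_of_mem_S {v s : V} (hv : v ≠ R.root) (hs : s ∈ R.S v) :
    R.below (R.par v) s := by
  rcases hs with rfl | hs
  · exact Relation.ReflTransGen.refl
  · exact (below_par hv).trans hs.1

/-- The path between two terminals of `I(e)` uses only edges of `I(e)`. -/
theorem below_of_onPath {v s s' y : V} (hv : v ≠ R.root) (hs : s ∈ R.S v) (hs' : s' ∈ R.S v)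
    (hy : R.onPath y s s') : R.below v y := by
  wlog h : R.below y s ∧ ¬ R.below y s' generalizing s s'
  · exact this hs' hs hy.symm (by unfold onPath at hy; tauto)
  have hpar : ¬ R.below y (R.par v) := fun h' => h.2 (h'.trans (below_par_of_mem_S hv hs'))
  rcases hs with rfl | hs
  · exact absurd h.1 hpar
  · rcases hs.1.total h.1 with h' | h'
    · exact h'
    · rcases h'.eq_or_par with rfl | ⟨_, h'⟩
      · exact Relation.ReflTransGen.refl
      · exact absurd h' hpar

/-- If no edge on the path from `x` down to `y` is cut by `X`, then `X` contains both or
neither of `x` and `y`. -/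
theorem mem_iff_of_below {X : Set V} {x y : V} (h : R.below x y)
    (hX : ∀ w, R.below x w → R.below w y → w ≠ x → (w ∈ X ↔ R.par w ∈ X)) :
    y ∈ X ↔ x ∈ X := by
  induction h with
  | refl => exact Iff.rfl
  | @tail b c h h' ih =>
    obtain ⟨rfl, hc⟩ := h'
    have hne : c ≠ x := by
      rintro rfl
      exact par_not_below hc h
    rw [hX c (h.tail ⟨rfl, hc⟩) Relation.ReflTransGen.refl hne]
    exact ih fun w hw hw' => hX w hw (hw'.trans (below_par hc))

/-- If the path between two terminals uses no edge of `E(X)`, then a vertex of this path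
lies in `X` if and only if its endpoints do. -/
theorem mem_iff_of_onPathV {v s s' x : V} {X : Set V} (hv : v ≠ R.root) (hs : s ∈ R.S v)
    (hs' : s' ∈ R.S v) (hcut : ∀ y, y ∈ R.cutE v X → ¬ R.onPath y s s')
    (hx : ∀ z, R.below z s → R.below z s' → R.below z x) (hxs : R.below x s) :
    s ∈ X ↔ x ∈ X := by
  refine mem_iff_of_below hxs fun w hw hws hne => ?_
  by_contra hwX
  have hp : R.onPath w s s' := Or.inl ⟨hws, fun h => hne ((hx w hws h).antisymm hw)⟩
  exact hcut w ⟨below_of_onPath hv hs hs' hp, hwX⟩ hp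

theorem exists_mem_cutE_onPath_of_mem [Finite V] {v s s' : V} {X : Set V} (hv : v ≠ R.root)
    (hs : s ∈ R.S v) (hs' : s' ∈ R.S v) (hsX : s ∈ X) (hsX' : s' ∉ X) :
    ∃ y, y ∈ R.cutE v X ∧ R.onPath y s s' := by
  by_contra! hcut
  obtain ⟨z, hz, hz', hmax⟩ := R.exists_lca s s'
  exact hsX' <| (mem_iff_of_onPathV hv hs' hs (fun y hy h => hcut y hy h.symm)
    (fun y h h' => hmax y h' h) hz').2 ((mem_iff_of_onPathV hv hs hs' hcut hmax hz).1 hsX)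

theorem leaf.eq_of_below {t s : V} (ht : R.leaf t) (h : R.below t s) : s = t := by
  rcases Relation.ReflTransGen.cases_head h with h | ⟨c, ⟨hc, hc'⟩, _⟩
  · exact h.symm
  · exact absurd hc (ht.2 c hc')

/-- The edge `e_t` at a leaf `t` lies exactly on the paths ending in `t`. -/
theorem leaf.onPath_iff {t a b : V} (ht : R.leaf t) (hab : a ≠ b) :
    R.onPath t a b ↔ t = a ∨ t = b := by
  have key : ∀ s, R.below t s ↔ t = s := fun s =>
    ⟨fun h => (ht.eq_of_below h).symm, fun h => h ▸ Relation.ReflTransGen.refl⟩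
  unfold onPath
  rw [key, key]
  constructor
  · tauto
  · rintro (rfl | rfl) <;> tauto

/-- The pairs whose tree path uses the edge `(par w, w)`. -/
def pairsThrough (R : RTI V) (w : V) : Set (Sym2 V) :=
  {p | ∃ t t', p = s(t, t') ∧ R.onPath w t t'}

theorem mem_pairsThrough {w a b : V} : s(a, b) ∈ R.pairsThrough w ↔ R.onPath w a b := by
  constructor
  · rintro ⟨t, t', h, ht⟩
    rcases Sym2.eq_iff.1 h with ⟨rfl, rfl⟩ | ⟨rfl, rfl⟩
    · exact ht
    · exact ht.symm
  · exact fun h => ⟨a, b, rfl, h⟩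

theorem IsDecomp.apply_eq [Fintype V] {v w : V} {f : V → ℕ} {g : Sym2 V → ℕ}
    (hg : R.IsDecomp v f g) (hw : R.below v w) :
    f w = ∑ p, g p * ({w} ∩ {x | p ∈ R.pairsThrough x}).ncard := by
  rw [hg.2 w hw, finsum_mem_def, finsum_eq_sum_of_fintype]
  refine Finset.sum_congr rfl fun p _ => ?_
  change Set.indicator (R.pairsThrough w) g p = _
  by_cases hp : p ∈ R.pairsThrough w
  · have : ({w} ∩ {x | p ∈ R.pairsThrough x} : Set V) = {w} :=
      Set.inter_eq_left.2 (by simpa using hp)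
    simp [hp, this]
  · have : ({w} ∩ {x | p ∈ R.pairsThrough x} : Set V) = ∅ := by
      simpa [Set.eq_empty_iff_forall_notMem] using hp
    simp [hp, this]

/-- The flow value of a set counts every path with the number of its edges in the cut. -/
theorem IsDecomp.hval_eq [Fintype V] {v : V} {f : V → ℕ} {g : Sym2 V → ℕ}
    (hg : R.IsDecomp v f g) (X : Set V) :
    R.hval v X f = ∑ p, g p * (R.cutE v X ∩ {x | p ∈ R.pairsThrough x}).ncard := by
  have hfin : (R.cutE v X).Finite := Set.toFinite _
  rw [hval, finsum_mem_eq_finite_toFinset_sum _ hfin]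
  rw [Finset.sum_congr rfl fun x hx => hg.apply_eq ((hfin.mem_toFinset.1 hx).1)]
  rw [Finset.sum_comm]
  refine Finset.sum_congr rfl fun p _ => ?_
  rw [← Finset.mul_sum]
  congr 1
  have h₁ : R.cutE v X ∩ {x | p ∈ R.pairsThrough x} =
      ↑(hfin.toFinset.filter fun x => p ∈ R.pairsThrough x) := by
    ext x
    simp
  rw [h₁, Set.ncard_coe_finset, Finset.card_filter]
  refine Finset.sum_congr rfl fun x _ => ?_
  split_ifs with h
  · rw [Set.inter_eq_left.2 (by simpa using h), Set.ncard_singleton]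
  · rw [Set.ncard_eq_zero]
    simpa [Set.eq_empty_iff_forall_notMem] using h

end RTI

/-- Lemma 1(i): let `f` be a feasible flow in `I(e)`, `e = (u,v)`, let
`t ∈ T_e`, and let `X_t` be a `t`-set with `f(X_t) = f(e_t)`.  Then every positive-path
`P_{s,s'}` of `f` with `s, s' ∈ T_e ∪ {u}` contains exactly one edge of `E(X_t)` if
`t ∈ {s,s'}`, and is vertex-disjoint from `X_t` otherwise. -/
theorem RTI.positivePath_tSet {V : Type*} [Fintype V] [DecidableEq V]
    (R : RTI V) (v : V) (hv : v ≠ R.root)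
    (f : V → ℕ) (hf : R.IsFlow v f) (hfc : R.Feasible v f)
    (t : V) (ht : t ∈ R.Te v)
    (X : Set V) (hXV : X ⊆ R.Ve v) (hXconn : R.ConnSet X) (hXt : X ∩ R.S v = {t})
    (hXf : R.hval v X f = f t)
    (s s' : V) (hs : s ∈ R.S v) (hs' : s' ∈ R.S v) (hss : s ≠ s')
    (g : Sym2 V → ℕ) (hg : R.IsDecomp v f g) (hpos : 0 < g s(s, s')) :
    (t = s ∨ t = s' → {x | x ∈ R.cutE v X ∧ R.onPath x s s'}.ncard = 1) ∧
    (t ≠ s → t ≠ s' → ∀ x, R.onPathV x s s' → x ∉ X) := by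
  have hSX : ∀ a ∈ R.S v, a ∈ X → a = t := fun a ha haX => by
    have : a ∈ X ∩ R.S v := ⟨haX, ha⟩
    rwa [hXt] at this
  have htX : t ∈ X := (hXt.symm ▸ Set.mem_singleton t : t ∈ X ∩ R.S v).1
  have hle : ∀ p ∈ (Finset.univ : Finset (Sym2 V)),
      g p * ({t} ∩ {x | p ∈ R.pairsThrough x}).ncard ≤
        g p * (R.cutE v X ∩ {x | p ∈ R.pairsThrough x}).ncard := by
    intro p _
    rcases Nat.eq_zero_or_pos (g p) with h0 | h0
    · simp [h0]
    refine Nat.mul_le_mul_left _ ?_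
    obtain ⟨a, b, ha, hb, hab, rfl⟩ := hg.1 p h0.ne'
    by_cases hp : R.onPath t a b
    · refine ((Set.ncard_le_ncard Set.inter_subset_left).trans_eq (Set.ncard_singleton t)).trans ?_
      rw [Nat.succ_le_iff, Set.ncard_pos]
      simp only [mem_pairsThrough]
      rcases (ht.2.onPath_iff hab).1 hp with rfl | rfl
      · exact exists_mem_cutE_onPath_of_mem hv ha hb htX fun h => hab (hSX b hb h).symm
      · obtain ⟨y, hy, hy'⟩ :=
          exists_mem_cutE_onPath_of_mem hv hb ha htX fun h => hab (hSX a ha h)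
        exact ⟨y, hy, hy'.symm⟩
    · have : ({t} ∩ {x | s(a, b) ∈ R.pairsThrough x} : Set V) = ∅ := by
        simpa [Set.eq_empty_iff_forall_notMem, mem_pairsThrough] using hp
      simp [this]
  have heq := hXf.symm
  rw [hg.apply_eq ht.1, hg.hval_eq, Finset.sum_eq_sum_iff_of_le hle] at heq
  have hcard := Nat.eq_of_mul_eq_mul_left hpos (heq s(s, s') (Finset.mem_univ _))
  simp only [mem_pairsThrough] at hcard
  change _ = {x | x ∈ R.cutE v X ∧ R.onPath x s s'}.ncard at hcard
  constructor
  · intro h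
    rw [← hcard, Set.inter_eq_left.2, Set.ncard_singleton]
    simpa using (ht.2.onPath_iff hss).2 h
  · intro hts hts' x hx hxX
    have hempty : ({t} ∩ {x | R.onPath x s s'} : Set V) = ∅ := by
      have : ¬ R.onPath t s s' := fun h => by
        rcases (ht.2.onPath_iff hss).1 h with h | h
        exacts [hts h, hts' h]
      simpa [Set.eq_empty_iff_forall_notMem] using this
    rw [hempty, Set.ncard_empty] at hcard
    have hcut : ∀ y, y ∈ R.cutE v X → ¬ R.onPath y s s' := fun y hy hy' =>
      Set.eq_empty_iff_forall_notMem.1 ((Set.ncard_eq_zero).1 hcard.symm) y ⟨hy, hy'⟩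
    rcases hx.1 with h | h
    · exact hts (hSX s hs ((mem_iff_of_onPathV hv hs hs' hcut hx.2 h).2 hxX)).symm
    · exact hts' (hSX s' hs' ((mem_iff_of_onPathV hv hs' hs (fun y hy hp => hcut y hy hp.symm)
        (fun z h h' => hx.2 z h' h) h).2 hxX)).symm
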